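/- Let u ≥ 2 and let F be a fixed nice u-graph with r = v(F) ≥ 4 vertices, and fix a function g = g(n) with g(n) → ∞ and g(n) = o(log n/log log n). Set π_+ = (aut(F)/r!)·(log n + g(n))/binom(n−1,r−1). Then with probability tending to 1 as n → ∞, the random F-graph H = H_F(n,π_+) satisfies all of the following: (i) no vertex has degree more than d̄(π_+) + max(d̄(π_+), 3 log n), where d̄(π) = (r/n)·M·π; (ii) the r-uniform multihypergraph of vertex sets of the F-edges of H contains no avoidable configuration; (iii) H has at most (log n)^{8g(n)} low-degree vertices, where a vertex is low-degree if its degree is at most 7g(n); (iv) H has at most (log n)^3 pairs of partner F-edges; and (v) H has no isolated vertex. -/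

import Mathlib

open Classical Filter Asymptotics MeasureTheory
open scoped ENNReal

noncomputable section

/-- The type of potential `F`-edges on vertex set `Fin n`: a pair consisting of the
`r`-element vertex set of the copy and the `u`-edge set of the copy. -/
abbrev FE (n : ℕ) := Finset (Fin n) × Finset (Finset (Fin n))

/-- `F` (a `u`-graph on `Fin r`) is strictly 1-balanced: every proper subgraph `(V', E')`
with more than one vertex has strictly smaller 1-density, i.e.
`e'/(v'-1) < e(F)/(r-1)`, written multiplicatively. -/
def StrictlyOneBalanced {r : ℕ} (F : Finset (Finset (Fin r))) : Prop :=
  ∀ (V' : Finset (Fin r)) (E' : Finset (Finset (Fin r))),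
    E' ⊆ F → (∀ e ∈ E', e ⊆ V') → 1 < V'.card → ¬(V' = Finset.univ ∧ E' = F) →
      E'.card * (r - 1) < F.card * (V'.card - 1)

/-- After deleting the vertices in `S`, the hypergraph `F` is connected. -/
def ConnectedAvoiding {r : ℕ} (F : Finset (Finset (Fin r))) (S : Finset (Fin r)) : Prop :=
  ∀ x y : Fin r, x ∉ S → y ∉ S →
    Relation.ReflTransGen (fun a b => ∃ e ∈ F, Disjoint e S ∧ a ∈ e ∧ b ∈ e) x y

/-- `F` is 3-connected: at least 4 vertices, and no set of at most 2 vertices disconnects it. -/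
def ThreeConnected {r : ℕ} (F : Finset (Finset (Fin r))) : Prop :=
  4 ≤ r ∧ ∀ S : Finset (Fin r), S.card ≤ 2 → ConnectedAvoiding F S

/-- Two edge sets on `Fin r` are isomorphic via a permutation of the vertices. -/
def EdgeIso {r : ℕ} (F F' : Finset (Finset (Fin r))) : Prop :=
  ∃ σ : Equiv.Perm (Fin r), F.image (fun e => e.image (fun x => σ x)) = F'

/-- `F` is nice: strictly 1-balanced, 3-connected and either `u ≥ 3` or `u = 2` and `F`
cannot be transformed into an isomorphic graph by adding one edge and deleting one edge. -/
def Nice {r : ℕ} (u : ℕ) (F : Finset (Finset (Fin r))) : Prop :=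
  StrictlyOneBalanced F ∧ ThreeConnected F ∧
    (3 ≤ u ∨ (u = 2 ∧ ¬ ∃ a b : Finset (Fin r), a.card = u ∧ a ∉ F ∧ b ∈ F ∧
      EdgeIso (insert a (F.erase b)) F))

/-- `h` is an `F`-edge on `[n]`: a copy of `F`, recorded as its (`r`-element) vertex set
together with its `u`-edge set. -/
def IsFEdge {r : ℕ} (F : Finset (Finset (Fin r))) (n : ℕ) (h : FE n) : Prop :=
  ∃ φ : Fin r ↪ Fin n, h.1 = Finset.univ.map φ ∧ h.2 = F.image (fun e => e.map φ)

/-- All possible `F`-edges on `[n]`. -/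
def allFEdges {r : ℕ} (F : Finset (Finset (Fin r))) (n : ℕ) : Finset (FE n) :=
  Finset.univ.filter (fun h => IsFEdge F n h)

/-- `M`, the total number of `F`-edges on `[n]`. -/
def Mnum {r : ℕ} (F : Finset (Finset (Fin r))) (n : ℕ) : ℕ := (allFEdges F n).card

/-- All `u`-element subsets of `[n]`. -/
def allUEdges (u n : ℕ) : Finset (Finset (Fin n)) :=
  Finset.univ.filter (fun e : Finset (Fin n) => e.card = u)

/-- The number of automorphisms of `F`. -/
def autCard {r : ℕ} (F : Finset (Finset (Fin r))) : ℕ :=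
  Fintype.card {σ : Equiv.Perm (Fin r) // F.image (fun e => e.image (fun x => σ x)) = F}

/-- The degree of a vertex `v` in an `F`-graph `H`. -/
def degFE {n : ℕ} (H : Finset (FE n)) (v : Fin n) : ℕ :=
  (H.filter (fun h => v ∈ h.1)).card

/-- Two `F`-edges are partners if their vertex sets share exactly `u` vertices. -/
def Partner (u : ℕ) {n : ℕ} (h h' : FE n) : Prop :=
  h ≠ h' ∧ (h.1 ∩ h'.1).card = u

/-- The state at time `t` of the process induced by the ordering `f`. -/
def proc {α : Type*} [DecidableEq α] {m : ℕ} (f : Fin m → α) (t : ℕ) : Finset α :=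
  (Finset.univ.filter (fun i : Fin m => (i : ℕ) < t)).image f

/-- A valid ordering of all `u`-element subsets of `[n]`. -/
def ValidOrdU (u n : ℕ) (f : Fin (Nat.choose n u) → Finset (Fin n)) : Prop :=
  Function.Injective f ∧ ∀ e : Finset (Fin n), e.card = u → ∃ i, f i = e

/-- A valid ordering of all `r`-element subsets of `[n]`. -/
def ValidOrdR (r n : ℕ) (f : Fin (Nat.choose n r) → Finset (Fin n)) : Prop :=
  Function.Injective f ∧ ∀ e : Finset (Fin n), e.card = r → ∃ i, f i = e

/-- A valid ordering of all `F`-edges on `[n]`. -/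
def ValidOrdH {r : ℕ} (F : Finset (Finset (Fin r))) (n : ℕ)
    (f : Fin (Mnum F n) → FE n) : Prop :=
  Function.Injective f ∧ ∀ h : FE n, IsFEdge F n h → ∃ i, f i = h

/-- `T_H`: the first time at which the `F`-graph process has no isolated vertices. -/
def THit {r : ℕ} (F : Finset (Finset (Fin r))) (n : ℕ) (f : Fin (Mnum F n) → FE n) : ℕ :=
  sInf {t : ℕ | ∀ v : Fin n, ∃ h ∈ proc f t, v ∈ h.1}

/-- `T_E`: the first time at which the `r`-uniform hypergraph process has no isolated
vertices. -/
def TEHit (r n : ℕ) (f : Fin (Nat.choose n r) → Finset (Fin n)) : ℕ :=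
  sInf {t : ℕ | ∀ v : Fin n, ∃ e ∈ proc f t, v ∈ e}

/-- `T_G`: the first time at which every vertex of `[n]` lies in a copy of `F` in the
`u`-graph process. -/
def TGHit (u : ℕ) {r : ℕ} (F : Finset (Finset (Fin r))) (n : ℕ)
    (f : Fin (Nat.choose n u) → Finset (Fin n)) : ℕ :=
  sInf {t : ℕ | ∀ v : Fin n, ∃ h : FE n, IsFEdge F n h ∧ v ∈ h.1 ∧ h.2 ⊆ proc f t}

/-- The random variable `X` is uniformly distributed over `{a | P a}` under `μ`. -/
def UniformOn {Ω α : Type*} (μ : PMF Ω) (X : Ω → α) (P : α → Prop) : Prop :=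
  μ.toOuterMeasure {ω | P (X ω)} = 1 ∧
    ∀ a b : α, P a → P b →
      μ.toOuterMeasure {ω | X ω = a} = μ.toOuterMeasure {ω | X ω = b}

/-- Under `μ`, the random set `X` contains each element of `all` independently with
probability `p` (a Bernoulli product / binomial random subset distribution). -/
def BernoulliVia {Ω E : Type*} (μ : PMF Ω) (X : Ω → Finset E)
    (all : Finset E) (p : ℝ) : Prop :=
  ∀ A : Finset E, μ.toOuterMeasure {ω | X ω = A} =
    if A ⊆ all then ENNReal.ofReal (p ^ A.card * (1 - p) ^ (all.card - A.card)) else 0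

/-- The function `g` tends to infinity and is `o(log n / log log n)`. -/
def GoodG (g : ℕ → ℝ) : Prop :=
  Tendsto g atTop atTop ∧ g =o[atTop] fun n : ℕ => Real.log n / Real.log (Real.log n)

/-- `π₊`, the probability at the end of the critical window. -/
def piPlus {r : ℕ} (F : Finset (Finset (Fin r))) (g : ℕ → ℝ) (n : ℕ) : ℝ :=
  ((autCard F : ℝ) / (Nat.factorial r : ℝ)) *
    ((Real.log n + g n) / ((n - 1).choose (r - 1) : ℝ))

/-- `π₋`, the probability at the start of the critical window. -/
def piMinus {r : ℕ} (F : Finset (Finset (Fin r))) (g : ℕ → ℝ) (n : ℕ) : ℝ :=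
  ((autCard F : ℝ) / (Nat.factorial r : ℝ)) *
    ((Real.log n - g n) / ((n - 1).choose (r - 1) : ℝ))

/-- `p₊ = (π₊/(1-n^{-δ}))^{1/s}` where `s = e(F)`. -/
def pPlus {r : ℕ} (F : Finset (Finset (Fin r))) (g : ℕ → ℝ) (δ : ℝ) (n : ℕ) : ℝ :=
  (piPlus F g n / (1 - (n : ℝ) ^ (-δ))) ^ ((1 : ℝ) / (F.card : ℝ))

/-- Connectivity (as a multihypergraph of vertex sets) of a set of `F`-edges. -/
def ConnFE {n : ℕ} (S : Finset (FE n)) : Prop :=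
  ∀ a ∈ S, ∀ b ∈ S,
    Relation.ReflTransGen (fun x y : FE n => x ∈ S ∧ y ∈ S ∧ (x.1 ∩ y.1).Nonempty) a b

/-- The multihypergraph of vertex sets of the `F`-edges of `H` contains an avoidable
configuration: a connected `S ⊆ H` with nullity `(r-1)e(S)+1-v(S) > 1` and
`e(S) ≤ 2^(r+1)`. -/
def HasAvoidable (r : ℕ) {n : ℕ} (H : Finset (FE n)) : Prop :=
  ∃ S ⊆ H, S.Nonempty ∧ ConnFE S ∧
    (S.sup Prod.fst).card < (r - 1) * S.card ∧ S.card ≤ 2 ^ (r + 1)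

/-- `G` contains an `F`-factor: pairwise vertex-disjoint copies of `F`, each a subgraph
of `G`, whose vertex sets partition `[n]`. -/
def HasFFactor {r : ℕ} (F : Finset (Finset (Fin r))) (n : ℕ)
    (G : Finset (Finset (Fin n))) : Prop :=
  ∃ C : Finset (FE n), (∀ h ∈ C, IsFEdge F n h ∧ h.2 ⊆ G) ∧
    (∀ h ∈ C, ∀ h' ∈ C, h ≠ h' → Disjoint h.1 h'.1) ∧
    C.sup Prod.fst = Finset.univ ∧ C.card * r = n

/-! ### Expectations over binomial random subsets -/

/-- Expectation of `X` over a binomial random subset of `all`. -/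
def Ex {E : Type*} (all : Finset E) (p : ℝ) (X : Finset E → ℝ) : ℝ :=
  ∑ A ∈ all.powerset, p ^ A.card * (1 - p) ^ (all.card - A.card) * X A

lemma Ex_zpow {E : Type*} (all : Finset E) (p z : ℝ) (P : E → Prop) [DecidablePred P] :
    Ex all p (fun A => z ^ (A.filter P).card) = (1 - p + p * z) ^ (all.filter P).card := by
  have h := Finset.prod_add (fun i => p * (if P i then z else 1)) (fun _ => 1 - p) all
  have h1 : ∏ i ∈ all, (p * (if P i then z else 1) + (1 - p))
      = (1 - p + p * z) ^ (all.filter P).card := by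
    rw [← Finset.prod_const, Finset.prod_filter]
    apply Finset.prod_congr rfl
    intro i _
    split_ifs <;> ring
  rw [← h1, h]
  unfold Ex
  apply Finset.sum_congr rfl
  intro A hA
  rw [Finset.mem_powerset] at hA
  rw [Finset.prod_mul_distrib, Finset.prod_const, Finset.prod_const,
    Finset.card_sdiff_of_subset hA, ← Finset.prod_filter, Finset.prod_const]
  ring

lemma Ex_subset {E : Type*} (all : Finset E) (p : ℝ) (S : Finset E) [∀ A, Decidable (S ⊆ A)] (hS : S ⊆ all) :
    Ex all p (fun A => if S ⊆ A then 1 else 0) = p ^ S.card := by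
  have h := Finset.prod_add (fun _ => p) (fun i => if i ∈ S then 0 else 1 - p) all
  have h1 : ∏ i ∈ all, (p + (if i ∈ S then 0 else 1 - p)) = p ^ S.card := by
    have : ∀ i ∈ all, (p + (if i ∈ S then 0 else 1 - p)) = if i ∈ S then p else 1 := by
      intro i _
      split_ifs <;> ring
    rw [Finset.prod_congr rfl this, ← Finset.prod_filter, Finset.prod_const,
      Finset.filter_mem_eq_inter, Finset.inter_eq_right.2 hS]
  rw [← h1, h]
  unfold Ex
  apply Finset.sum_congr rfl
  intro A hA
  rw [Finset.mem_powerset] at hA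
  rw [Finset.prod_const]
  beta_reduce
  by_cases hSA : S ⊆ A
  · rw [if_pos hSA, mul_one]
    have : ∀ i ∈ all \ A, (if i ∈ S then 0 else 1 - p) = 1 - p := by
      intro i hi
      rw [if_neg]
      exact fun h => (Finset.mem_sdiff.1 hi).2 (hSA h)
    rw [Finset.prod_congr rfl this, Finset.prod_const, Finset.card_sdiff_of_subset hA]
  · rw [if_neg hSA, mul_zero]
    obtain ⟨i, hi, hiA⟩ := Finset.not_subset.1 hSA
    rw [Finset.prod_eq_zero (i := i), mul_zero]
    · exact Finset.mem_sdiff.2 ⟨hS hi, hiA⟩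
    · rw [if_pos hi]

lemma Ex_sum {E ι : Type*} (all : Finset E) (p : ℝ) (s : Finset ι) (X : ι → Finset E → ℝ) :
    Ex all p (fun A => ∑ i ∈ s, X i A) = ∑ i ∈ s, Ex all p (X i) := by
  unfold Ex
  rw [Finset.sum_comm]
  simp_rw [Finset.mul_sum]

lemma Ex_smul {E : Type*} (all : Finset E) (p c : ℝ) (X : Finset E → ℝ) :
    Ex all p (fun A => c * X A) = c * Ex all p X := by
  unfold Ex
  rw [Finset.mul_sum]
  apply Finset.sum_congr rfl
  intros
  ring

lemma markov {E : Type*} [Fintype E] (μ : PMF (Finset E)) (all : Finset E) (p : ℝ)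
    (hp0 : 0 ≤ p) (hp1 : p ≤ 1) (hμ : BernoulliVia μ id all p) (S : Set (Finset E))
    (X : Finset E → ℝ) (hX : ∀ A, 0 ≤ X A) (hS : ∀ A ∈ S, A ⊆ all → 1 ≤ X A) :
    μ.toOuterMeasure S ≤ ENNReal.ofReal (Ex all p X) := by
  have hm : ∀ A, μ A =
      if A ⊆ all then ENNReal.ofReal (p ^ A.card * (1 - p) ^ (all.card - A.card)) else 0 := by
    intro A
    rw [← hμ A, ← PMF.toOuterMeasure_apply_singleton]
    rfl
  have h1p : 0 ≤ 1 - p := by linarith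
  rw [PMF.toOuterMeasure_apply_fintype]
  unfold Ex
  rw [ENNReal.ofReal_sum_of_nonneg]
  swap
  · intro A _
    have := hX A
    positivity
  rw [← Finset.sum_subset (Finset.subset_univ all.powerset)]
  · apply Finset.sum_le_sum
    intro A hA
    rw [Finset.mem_powerset] at hA
    by_cases hAS : A ∈ S
    · rw [Set.indicator_of_mem hAS, hm, if_pos hA]
      apply ENNReal.ofReal_le_ofReal
      have := hS A hAS hA
      have : 0 ≤ p ^ A.card * (1 - p) ^ (all.card - A.card) := by positivity
      nlinarith
    · rw [Set.indicator_of_notMem hAS]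
      exact zero_le
  · intro A _ hA
    rw [Finset.mem_powerset] at hA
    by_cases hAS : A ∈ S
    · rw [Set.indicator_of_mem hAS, hm, if_neg hA]
    · rw [Set.indicator_of_notMem hAS]

lemma mgf_le {p z : ℝ} (hp0 : 0 ≤ p) (hp1 : p ≤ 1) (hz : 0 ≤ z) (N : ℕ) :
    (1 - p + p * z) ^ N ≤ Real.exp (N * p * (z - 1)) := by
  have h1 : 1 - p + p * z ≤ Real.exp (p * (z - 1)) := by
    have := Real.add_one_le_exp (p * (z - 1))
    linarith
  have h0 : 0 ≤ 1 - p + p * z := by nlinarith [mul_nonneg hp0 hz]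
  calc _ ≤ (Real.exp (p * (z - 1))) ^ N := pow_le_pow_left₀ h0 h1 N
    _ = _ := by rw [← Real.exp_nat_mul]; ring_nf

/-! ### Counting F-edges -/

/-- The F-edge of an embedding. -/
def mkFE {r n : ℕ} (F : Finset (Finset (Fin r))) (φ : Fin r ↪ Fin n) : FE n :=
  (Finset.univ.map φ, F.image (fun e => e.map φ))

lemma mem_all {r n : ℕ} (F : Finset (Finset (Fin r))) (h : FE n) :
    h ∈ allFEdges F n ↔ ∃ φ, mkFE F φ = h := by
  unfold allFEdges IsFEdge mkFE
  simp only [Finset.mem_filter, Finset.mem_univ, true_and]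
  constructor
  · rintro ⟨φ, h1, h2⟩; exact ⟨φ, Prod.ext h1.symm h2.symm⟩
  · rintro ⟨φ, rfl⟩; exact ⟨φ, rfl, rfl⟩

lemma fiber_card {r n : ℕ} (F : Finset (Finset (Fin r))) (φ₀ : Fin r ↪ Fin n) :
    (Finset.univ.filter (fun φ : Fin r ↪ Fin n => mkFE F φ = mkFE F φ₀)).card = autCard F := by
  unfold autCard
  rw [Fintype.card_subtype]
  symm
  have key : ∀ σ : Equiv.Perm (Fin r), mkFE F (σ.toEmbedding.trans φ₀) = mkFE F φ₀ ↔
      F.image (fun e => e.image (fun x => σ x)) = F := by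
    intro σ
    have h1 : F.image (fun e => e.map (σ.toEmbedding.trans φ₀))
        = (F.image (fun e => e.image (fun x => σ x))).image (fun e => e.map φ₀) := by
      rw [Finset.image_image]
      apply Finset.image_congr
      intro e _
      simp only [Function.comp]
      rw [← Finset.map_map, Finset.map_eq_image (f := σ.toEmbedding)]
      rfl
    have h2 : Finset.univ.map (σ.toEmbedding.trans φ₀) = Finset.univ.map φ₀ := by
      rw [← Finset.map_map, Finset.map_univ_equiv]
    have h3 : Function.Injective (fun e : Finset (Fin r) => e.map φ₀) :=
      Finset.map_injective φ₀
    unfold mkFE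
    rw [Prod.mk.injEq, h1, h2]
    simp only [true_and]
    exact (Finset.image_injective h3).eq_iff
  refine Finset.card_bij (fun σ _ => σ.toEmbedding.trans φ₀) ?_ ?_ ?_
  · intro σ hσ
    simp only [Finset.mem_filter, Finset.mem_univ, true_and] at hσ ⊢
    exact (key σ).2 hσ
  · intro σ _ τ _ h
    ext x
    have := DFunLike.congr_fun h x
    simp at this
    rw [this]
  · intro φ hφ
    simp only [Finset.mem_filter, Finset.mem_univ, true_and] at hφ
    have hr : Finset.univ.map φ = Finset.univ.map φ₀ := congrArg Prod.fst hφ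
    have : ∀ x, ∃ y, φ₀ y = φ x := by
      intro x
      have : φ x ∈ Finset.univ.map φ₀ := by rw [← hr]; simp
      simpa using this
    choose s hs using this
    have hinj : Function.Injective s := by
      intro a b hab
      apply φ.injective
      rw [← hs, ← hs, hab]
    let σ : Equiv.Perm (Fin r) := Equiv.ofBijective s (Finite.injective_iff_bijective.1 hinj)
    have e : σ.toEmbedding.trans φ₀ = φ := by
      ext x
      simp [σ, hs]
    refine ⟨σ, ?_, e⟩
    simp only [Finset.mem_filter, Finset.mem_univ, true_and]
    rw [← key, e]
    exact hφ

lemma autCard_pos {r : ℕ} (F : Finset (Finset (Fin r))) : 0 < autCard F := by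
  unfold autCard
  rw [Fintype.card_pos_iff]
  exact ⟨⟨1, by simp⟩⟩

lemma count_filter {r n : ℕ} (F : Finset (Finset (Fin r))) (P : FE n → Prop) [DecidablePred P] :
    ((allFEdges F n).filter P).card * autCard F =
      (Finset.univ.filter (fun φ : Fin r ↪ Fin n => P (mkFE F φ))).card := by
  rw [Finset.card_eq_sum_card_fiberwise (f := mkFE F) (t := (allFEdges F n).filter P)]
  · rw [← smul_eq_mul, ← Finset.sum_const]
    apply Finset.sum_congr rfl
    intro h hh
    rw [Finset.mem_filter, mem_all] at hh
    obtain ⟨⟨φ₀, rfl⟩, hP⟩ := hh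
    rw [← fiber_card F φ₀, Finset.filter_filter]
    congr 1
    ext φ
    simp only [Finset.mem_filter, Finset.mem_univ, true_and]
    constructor
    · intro h; exact ⟨by rw [h]; exact hP, h⟩
    · exact fun h => h.2
  · intro φ hφ
    simp only [Finset.coe_filter, Finset.mem_univ, true_and, Set.mem_ofPred_eq] at hφ ⊢
    exact ⟨(mem_all F _).2 ⟨φ, rfl⟩, hφ⟩

lemma Mnum_aut {r : ℕ} (F : Finset (Finset (Fin r))) (n : ℕ) :
    Mnum F n * autCard F = n.descFactorial r := by
  have := count_filter (n := n) F (fun _ => True)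
  simp only [Finset.filter_true] at this
  rw [Mnum, this, Finset.card_univ, Fintype.card_embedding_eq]
  simp

/-- Number of F-edges through `v`. -/
def Nv {r : ℕ} (F : Finset (Finset (Fin r))) {n : ℕ} (v : Fin n) : ℕ :=
  ((allFEdges F n).filter (fun h => v ∈ h.1)).card

lemma emb_count {r n : ℕ} (v : Fin n) :
    n * (Finset.univ.filter (fun φ : Fin r ↪ Fin n => v ∈ Finset.univ.map φ)).card
      = r * n.descFactorial r := by
  have hsymm : ∀ w : Fin n,
      (Finset.univ.filter (fun φ : Fin r ↪ Fin n => w ∈ Finset.univ.map φ)).card =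
      (Finset.univ.filter (fun φ : Fin r ↪ Fin n => v ∈ Finset.univ.map φ)).card := by
    intro w
    refine Finset.card_bij (fun φ _ => φ.trans (Equiv.swap v w).toEmbedding) ?_ ?_ ?_
    · intro φ hφ
      simp only [Finset.mem_filter, Finset.mem_univ, true_and, Finset.mem_map] at hφ ⊢
      obtain ⟨i, hi⟩ := hφ
      exact ⟨i, by simp [hi]⟩
    · intro φ _ ψ _ h
      ext x
      have := DFunLike.congr_fun h x
      simp at this
      rw [this]
    · intro φ hφ
      simp only [Finset.mem_filter, Finset.mem_univ, true_and, Finset.mem_map] at hφ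
      obtain ⟨i, hi⟩ := hφ
      refine ⟨φ.trans (Equiv.swap v w).toEmbedding, ?_, ?_⟩
      · simp only [Finset.mem_filter, Finset.mem_univ, true_and, Finset.mem_map]
        exact ⟨i, by simp [hi]⟩
      · ext x
        simp
  have hs : ∑ w : Fin n,
      (Finset.univ.filter (fun φ : Fin r ↪ Fin n => w ∈ Finset.univ.map φ)).card
      = r * n.descFactorial r := by
    have := Finset.sum_card_bipartiteAbove_eq_sum_card_bipartiteBelow
      (s := (Finset.univ : Finset (Fin n))) (t := (Finset.univ : Finset (Fin r ↪ Fin n)))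
      (fun w φ => w ∈ Finset.univ.map φ)
    unfold Finset.bipartiteAbove Finset.bipartiteBelow at this
    rw [this]
    have h2 : ∀ φ : Fin r ↪ Fin n,
        (Finset.univ.filter (fun w => w ∈ Finset.univ.map φ)).card = r := by
      intro φ
      rw [Finset.filter_mem_eq_inter, Finset.univ_inter, Finset.card_map]
      simp
    simp_rw [h2]
    rw [Finset.sum_const, Finset.card_univ, Fintype.card_embedding_eq]
    simp [mul_comm]
  rw [Finset.sum_congr rfl (fun w _ => hsymm w)] at hs
  simpa using hs

lemma Nv_aut {r n : ℕ} (hr : 1 ≤ r) (F : Finset (Finset (Fin r))) (v : Fin n) :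
    Nv F v * autCard F = r.factorial * (n - 1).choose (r - 1) := by
  have h1 : Nv F v * autCard F =
      (Finset.univ.filter (fun φ : Fin r ↪ Fin n => v ∈ (mkFE F φ).1)).card :=
    count_filter F (fun h => v ∈ h.1)
  have h2 := emb_count (r := r) v
  have hn : 0 < n := v.pos
  rw [h1]
  apply Nat.eq_of_mul_eq_mul_left hn
  unfold mkFE
  rw [h2]
  obtain ⟨m, rfl⟩ : ∃ m, n = m + 1 := ⟨n - 1, by omega⟩
  obtain ⟨k, rfl⟩ : ∃ k, r = k + 1 := ⟨r - 1, by omega⟩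
  rw [Nat.succ_descFactorial_succ, Nat.descFactorial_eq_factorial_mul_choose,
    Nat.factorial_succ]
  simp only [Nat.add_sub_cancel]
  ring

lemma Nv_Mnum {r n : ℕ} (F : Finset (Finset (Fin r))) (v : Fin n) :
    n * Nv F v = r * Mnum F n := by
  have h1 : Nv F v * autCard F =
      (Finset.univ.filter (fun φ : Fin r ↪ Fin n => v ∈ (mkFE F φ).1)).card :=
    count_filter F (fun h => v ∈ h.1)
  have h2 := emb_count (r := r) v
  apply Nat.eq_of_mul_eq_mul_right (autCard_pos F)
  rw [mul_assoc, mul_assoc, Mnum_aut, h1]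
  exact h2

lemma Nv_pi {r n : ℕ} (hr : 1 ≤ r) (hn : r ≤ n) (F : Finset (Finset (Fin r))) (g : ℕ → ℝ)
    (v : Fin n) : (Nv F v : ℝ) * piPlus F g n = Real.log n + g n := by
  have h : (Nv F v : ℝ) * autCard F = r.factorial * (n - 1).choose (r - 1) := by
    exact_mod_cast Nv_aut hr F v
  have hc : ((n - 1).choose (r - 1) : ℝ) ≠ 0 := by
    have : 0 < (n - 1).choose (r - 1) := Nat.choose_pos (by omega)
    positivity
  have hf : (r.factorial : ℝ) ≠ 0 := by positivity
  unfold piPlus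
  calc _ = ((Nv F v : ℝ) * autCard F) * ((Real.log n + g n)) /
        (r.factorial * ((n - 1).choose (r - 1) : ℝ)) := by field_simp
    _ = _ := by rw [h]; field_simp

lemma dbar_eq {r n : ℕ} (hr : 1 ≤ r) (hn : r ≤ n) (F : Finset (Finset (Fin r))) (g : ℕ → ℝ) :
    (r : ℝ) / n * (Mnum F n : ℝ) * piPlus F g n = Real.log n + g n := by
  have v : Fin n := ⟨0, by omega⟩
  rw [← Nv_pi hr hn F g v]
  have h : (n : ℝ) * Nv F v = r * Mnum F n := by exact_mod_cast Nv_Mnum F v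
  have hn : (n : ℝ) ≠ 0 := by
    have : 0 < n := by omega
    positivity
  congr 1
  field_simp
  linarith

/-! ### Counting small configurations -/

/-- Push an F-edge along a map. -/
def push {a b : ℕ} (f : Fin a → Fin b) (h : FE a) : FE b :=
  (h.1.image f, h.2.image (fun e => e.image f))

lemma push_id {n m : ℕ} (f : Fin m → Fin n) (s : Fin n → Fin m) (U : Finset (Fin n))
    (hU : ∀ x ∈ U, f (s x) = x) (h : FE n) (h1 : h.1 ⊆ U) (h2 : ∀ e ∈ h.2, e ⊆ h.1) :
    push f (push s h) = h := by
  have key : ∀ e : Finset (Fin n), e ⊆ U → (e.image s).image f = e := by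
    intro e he
    rw [Finset.image_image]
    conv_rhs => rw [← Finset.image_id (s := e)]
    apply Finset.image_congr
    intro x hx
    exact hU x (he hx)
  unfold push
  refine Prod.ext (key _ h1) ?_
  simp only
  rw [Finset.image_image]
  conv_rhs => rw [← Finset.image_id (s := h.2)]
  apply Finset.image_congr
  intro e he
  exact key e ((h2 e he).trans h1)

/-- Number of configurations on `m` vertices. -/
def cfgCard (m : ℕ) : ℝ := Fintype.card (Finset (FE m))

lemma cfgCard_nonneg (m : ℕ) : 0 ≤ cfgCard m := Nat.cast_nonneg _

lemma ofReal_add5 {a b c d e : ℝ} (ha : 0 ≤ a) (hb : 0 ≤ b) (hc : 0 ≤ c) (hd : 0 ≤ d)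
    (he : 0 ≤ e) : ENNReal.ofReal (a + b + c + d + e) = ENNReal.ofReal a + ENNReal.ofReal b +
      ENNReal.ofReal c + ENNReal.ofReal d + ENNReal.ofReal e := by
  rw [ENNReal.ofReal_add (by positivity) he, ENNReal.ofReal_add (by positivity) hd,
    ENNReal.ofReal_add (by positivity) hc, ENNReal.ofReal_add ha hb]

lemma family_card {n m : ℕ} (hn : 0 < n) (hm : 0 < m) (T : Finset (Finset (FE n)))
    (hT : ∀ S ∈ T, (∀ h ∈ S, ∀ e ∈ h.2, e ⊆ h.1) ∧ (S.sup Prod.fst).card ≤ m) :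
    T.card ≤ Fintype.card (Finset (FE m)) * n ^ m := by
  have hsub : T ⊆ (Finset.univ : Finset ((Fin m → Fin n) × Finset (FE m))).image
      (fun q => q.2.image (push q.1)) := by
    intro S hS
    obtain ⟨h1, h2⟩ := hT S hS
    set U := S.sup Prod.fst with hUdef
    have hcard : Fintype.card U ≤ Fintype.card (Fin m) := by simpa using h2
    obtain ⟨ι⟩ := Function.Embedding.nonempty_of_card_le hcard
    let s : Fin n → Fin m := fun x => if hx : x ∈ U then ι ⟨x, hx⟩ else ⟨0, hm⟩
    let f : Fin m → Fin n := fun i => if hi : ∃ y, ι y = i then (hi.choose : Fin n) else ⟨0, hn⟩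
    have hfs : ∀ x ∈ U, f (s x) = x := by
      intro x hx
      have hs : s x = ι ⟨x, hx⟩ := by simp [s, hx]
      have he : ∃ y, ι y = s x := ⟨_, hs.symm⟩
      have hf : f (s x) = he.choose := by
        simp only [f]; rw [dif_pos he]
      rw [hf]
      exact congrArg Subtype.val (ι.injective (he.choose_spec.trans hs))
    rw [Finset.mem_image]
    refine ⟨(f, S.image (push s)), Finset.mem_univ _, ?_⟩
    simp only
    rw [Finset.image_image]
    conv_rhs => rw [← Finset.image_id (s := S)]
    apply Finset.image_congr
    intro h hh
    exact push_id f s U hfs h (Finset.le_sup (f := Prod.fst) hh) (h1 h hh)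
  calc T.card ≤ _ := Finset.card_le_card hsub
    _ ≤ _ := Finset.card_image_le
    _ = _ := by
      rw [Finset.card_univ, Fintype.card_prod, mul_comm]
      congr 1
      simp

lemma all_sub {r n : ℕ} (F : Finset (Finset (Fin r))) (h : FE n) (hh : h ∈ allFEdges F n) :
    h.1.card = r ∧ ∀ e ∈ h.2, e ⊆ h.1 := by
  obtain ⟨φ, rfl⟩ := (mem_all F h).1 hh
  constructor
  · simp [mkFE]
  · intro e he
    simp only [mkFE, Finset.mem_image] at he ⊢
    obtain ⟨e', _, rfl⟩ := he
    exact Finset.map_subset_map.2 (Finset.subset_univ _)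

lemma pi_bound {r n : ℕ} (hr : 1 ≤ r) (hn : 2 * r ≤ n) (F : Finset (Finset (Fin r))) (g : ℕ → ℝ)
    (hl : 0 ≤ Real.log n + g n) :
    piPlus F g n * (n : ℝ) ^ (r - 1) ≤
      (autCard F : ℝ) / r.factorial * (2 ^ (r - 1) * (r - 1).factorial) * (Real.log n + g n) := by
  have hc : (0 : ℝ) < ((n - 1).choose (r - 1) : ℝ) := by
    have : 0 < (n - 1).choose (r - 1) := Nat.choose_pos (by omega)
    positivity
  have h1 : (n : ℝ) ^ (r - 1) ≤ 2 ^ (r - 1) * (r - 1).factorial * ((n - 1).choose (r - 1) : ℝ) := by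
    have h2 : (n - 1 + 1 - (r - 1)) ^ (r - 1) ≤ (n - 1).descFactorial (r - 1) :=
      Nat.pow_sub_le_descFactorial _ _
    rw [Nat.descFactorial_eq_factorial_mul_choose] at h2
    have h3 : n ^ (r - 1) ≤ 2 ^ (r - 1) * (n - 1 + 1 - (r - 1)) ^ (r - 1) := by
      rw [← mul_pow]
      exact Nat.pow_le_pow_left (by omega) _
    have h4 : n ^ (r - 1) ≤ 2 ^ (r - 1) * ((r - 1).factorial * (n - 1).choose (r - 1)) :=
      h3.trans (Nat.mul_le_mul_left _ h2)
    have : ((n ^ (r - 1) : ℕ) : ℝ) ≤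
      ((2 ^ (r - 1) * ((r - 1).factorial * (n - 1).choose (r - 1)) : ℕ) : ℝ) := by
      exact_mod_cast h4
    push_cast at this
    linarith
  unfold piPlus
  calc _ = (autCard F : ℝ) / r.factorial * (Real.log n + g n) *
        ((n : ℝ) ^ (r - 1) / ((n - 1).choose (r - 1) : ℝ)) := by field_simp
    _ ≤ (autCard F : ℝ) / r.factorial * (Real.log n + g n) *
        (2 ^ (r - 1) * (r - 1).factorial) := by
      apply mul_le_mul_of_nonneg_left
      · rw [div_le_iff₀ hc]; exact h1
      · positivity
    _ = _ := by ring

section events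

lemma Ex_deg {r n : ℕ} (F : Finset (Finset (Fin r))) {p z : ℝ} (hp0 : 0 ≤ p) (hp1 : p ≤ 1)
    (hz : 0 ≤ z) (v : Fin n) :
    Ex (allFEdges F n) p (fun A => z ^ degFE A v) ≤ Real.exp (Nv F v * p * (z - 1)) := by
  unfold degFE
  rw [Ex_zpow]
  exact mgf_le hp0 hp1 hz _

lemma Ex_degsum {r n : ℕ} (F : Finset (Finset (Fin r))) {p z l c : ℝ} (hp0 : 0 ≤ p)
    (hp1 : p ≤ 1) (hz : 0 ≤ z) (hc : 0 ≤ c) (hN : ∀ v : Fin n, Nv F v * p = l) :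
    Ex (allFEdges F n) p (fun A => c * ∑ v : Fin n, z ^ degFE A v)
      ≤ c * (n * Real.exp (l * (z - 1))) := by
  rw [Ex_smul, Ex_sum]
  apply mul_le_mul_of_nonneg_left _ hc
  calc _ ≤ ∑ v : Fin n, Real.exp (l * (z - 1)) := by
        apply Finset.sum_le_sum
        intro v _
        rw [← hN v]
        exact Ex_deg F hp0 hp1 hz v
    _ = _ := by simp

lemma bad1 {r n : ℕ} (F : Finset (Finset (Fin r))) {p L g : ℝ} (hp0 : 0 ≤ p) (hp1 : p ≤ 1)
    (μ : PMF (Finset (FE n))) (hμ : BernoulliVia μ id (allFEdges F n) p)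
    (hN : ∀ v : Fin n, Nv F v * p = L + g) (hnL : (n : ℝ) = Real.exp L)
    (hg0 : 0 ≤ g) (hgL : g ≤ L) :
    μ.toOuterMeasure {H | ¬ ∀ v : Fin n, (degFE H v : ℝ) ≤ (L + g) + max (L + g) (3 * L)} ≤
      ENNReal.ofReal (Real.exp (-(L / 2))) := by
  refine (markov μ _ p hp0 hp1 hμ _
    (fun A => Real.exp (-((L + g) + 3 * L)) * ∑ v : Fin n, Real.exp 1 ^ degFE A v)
    ?_ ?_).trans (ENNReal.ofReal_le_ofReal ((Ex_degsum F hp0 hp1 (Real.exp_pos 1).le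
      (Real.exp_pos _).le hN).trans ?_))
  · intro A; positivity
  · intro A hA _
    simp only [Set.mem_ofPred_eq, not_forall, not_le] at hA
    obtain ⟨v, hv⟩ := hA
    have h1 : Real.exp 1 ^ degFE A v ≤ ∑ v : Fin n, Real.exp 1 ^ degFE A v :=
      Finset.single_le_sum (f := fun v => Real.exp 1 ^ degFE A v)
        (fun i _ => by positivity) (Finset.mem_univ v)
    refine le_trans ?_ (mul_le_mul_of_nonneg_left h1 (Real.exp_pos _).le)
    rw [← Real.exp_nat_mul, ← Real.exp_add]
    apply Real.one_le_exp
    have := le_max_right (L + g) (3 * L)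
    linarith
  · rw [hnL, ← Real.exp_add, ← Real.exp_add]
    apply Real.exp_le_exp.2
    have := Real.exp_one_lt_d9
    have : 2.7 < Real.exp 1 := by linarith [Real.exp_one_gt_d9]
    nlinarith

lemma bad5 {r n : ℕ} (F : Finset (Finset (Fin r))) {p L g : ℝ} (hp0 : 0 ≤ p) (hp1 : p ≤ 1)
    (μ : PMF (Finset (FE n))) (hμ : BernoulliVia μ id (allFEdges F n) p)
    (hN : ∀ v : Fin n, Nv F v * p = L + g) (hnL : (n : ℝ) = Real.exp L) :
    μ.toOuterMeasure {H | ¬ ∀ v : Fin n, ∃ h ∈ H, v ∈ h.1} ≤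
      ENNReal.ofReal (Real.exp (-g)) := by
  refine (markov μ _ p hp0 hp1 hμ _
    (fun A => 1 * ∑ v : Fin n, (0 : ℝ) ^ degFE A v)
    ?_ ?_).trans (ENNReal.ofReal_le_ofReal ((Ex_degsum F hp0 hp1 le_rfl
      zero_le_one hN).trans ?_))
  · intro A; positivity
  · intro A hA _
    simp only [Set.mem_ofPred_eq, not_forall] at hA
    obtain ⟨v, hv⟩ := hA
    have h1 : (0 : ℝ) ^ degFE A v ≤ ∑ v : Fin n, (0 : ℝ) ^ degFE A v :=
      Finset.single_le_sum (f := fun v => (0 : ℝ) ^ degFE A v)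
        (fun i _ => by positivity) (Finset.mem_univ v)
    have h2 : degFE A v = 0 := by
      unfold degFE
      rw [Finset.card_eq_zero, Finset.filter_eq_empty_iff]
      intro h hh hv'
      exact hv ⟨h, hh, hv'⟩
    rw [h2, pow_zero] at h1
    linarith
  · rw [hnL, one_mul, ← Real.exp_add]
    apply Real.exp_le_exp.2
    linarith

lemma bad3 {r n : ℕ} (F : Finset (Finset (Fin r))) {p L g : ℝ} (hp0 : 0 ≤ p) (hp1 : p ≤ 1)
    (μ : PMF (Finset (FE n))) (hμ : BernoulliVia μ id (allFEdges F n) p)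
    (hN : ∀ v : Fin n, Nv F v * p = L + g) (hnL : (n : ℝ) = Real.exp L)
    (hg0 : 0 ≤ g) (hgL : g ≤ L) (hL : 1 ≤ L) (hLL : 7 * Real.log 2 ≤ Real.log L) :
    μ.toOuterMeasure {H | ¬ ((Finset.univ.filter
        (fun v : Fin n => (degFE H v : ℝ) ≤ 7 * g)).card : ℝ) ≤ L ^ (8 * g)} ≤
      ENNReal.ofReal (Real.exp (1 - g)) := by
  have hl1 : 1 ≤ L + g := by linarith
  have hl0 : 0 < L + g := by linarith
  have hL0 : 0 < L := by linarith
  have hLp : 0 < L ^ (8 * g) := Real.rpow_pos_of_pos hL0 _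
  refine (markov μ _ p hp0 hp1 hμ _
    (fun A => ((L + g) ^ (7 * g) / L ^ (8 * g)) * ∑ v : Fin n, ((L + g)⁻¹) ^ degFE A v)
    ?_ ?_).trans (ENNReal.ofReal_le_ofReal ((Ex_degsum F hp0 hp1 (inv_nonneg.2 hl0.le)
      (by positivity) hN).trans ?_))
  · intro A; positivity
  · intro A hA _
    simp only [Set.mem_ofPred_eq, not_le] at hA
    have h1 : ((Finset.univ.filter (fun v : Fin n => (degFE A v : ℝ) ≤ 7 * g)).card : ℝ) ≤
        (L + g) ^ (7 * g) * ∑ v : Fin n, ((L + g)⁻¹) ^ degFE A v := by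
      rw [Finset.card_filter, Finset.mul_sum]
      push_cast
      apply Finset.sum_le_sum
      intro v _
      split_ifs with hv
      · rw [inv_pow, ← Real.rpow_natCast, ← Real.rpow_neg hl0.le, ← Real.rpow_add hl0]
        exact Real.one_le_rpow hl1 (by linarith)
      · positivity
    rw [div_mul_eq_mul_div, le_div_iff₀ hLp, one_mul]
    linarith
  · have e1 : (L + g) * ((L + g)⁻¹ - 1) = 1 - (L + g) := by field_simp
    have hlog : Real.log (L + g) ≤ Real.log 2 + Real.log L := by
      rw [← Real.log_mul (by norm_num) hL0.ne']
      exact Real.log_le_log hl0 (by linarith)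
    rw [e1, hnL, Real.rpow_def_of_pos hl0, Real.rpow_def_of_pos hL0, ← Real.exp_sub,
      ← Real.exp_add, ← Real.exp_add]
    apply Real.exp_le_exp.2
    nlinarith

lemma bad_config {r n : ℕ} (F : Finset (Finset (Fin r))) {p : ℝ} (k m : ℕ) (hp0 : 0 ≤ p)
    (hn : 0 < n) (hm : 0 < m) (T : Finset (Finset (FE n)))
    (hT : ∀ S ∈ T, S ⊆ allFEdges F n ∧ S.card = k ∧ (S.sup Prod.fst).card ≤ m) :
    Ex (allFEdges F n) p (fun A => ∑ S ∈ T, if S ⊆ A then 1 else 0) ≤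
      cfgCard m * (n : ℝ) ^ m * p ^ k := by
  rw [Ex_sum]
  have h1 : ∀ S ∈ T, Ex (allFEdges F n) p (fun A => if S ⊆ A then 1 else 0) = p ^ k := by
    intro S hS
    rw [Ex_subset _ _ _ (hT S hS).1, (hT S hS).2.1]
  rw [Finset.sum_congr rfl h1, Finset.sum_const, nsmul_eq_mul]
  apply mul_le_mul_of_nonneg_right _ (by positivity)
  have := family_card hn hm T (fun S hS =>
    ⟨fun h hh => (all_sub F h ((hT S hS).1 hh)).2, (hT S hS).2.2⟩)
  unfold cfgCard
  exact_mod_cast this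

lemma bad4 {r n u : ℕ} (hu : 2 ≤ u) (hr : 4 ≤ r) (hn : 0 < n) (F : Finset (Finset (Fin r)))
    {p L C : ℝ} (hp0 : 0 ≤ p) (hp1 : p ≤ 1)
    (μ : PMF (Finset (FE n))) (hμ : BernoulliVia μ id (allFEdges F n) p)
    (hL : 0 < L) (hC : p * (n : ℝ) ^ (r - 1) ≤ C * L) :
    μ.toOuterMeasure {H | ¬ (((H.powersetCard 2).filter
                 (fun P => ∃ a ∈ P, ∃ b ∈ P, Partner u a b)).card : ℝ) ≤ L ^ (3 : ℕ)} ≤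
      ENNReal.ofReal (cfgCard (2 * r - 2) * C ^ 2 / L) := by
  set T := ((allFEdges F n).powersetCard 2).filter
                 (fun P => ∃ a ∈ P, ∃ b ∈ P, Partner u a b) with hTdef
  refine (markov μ _ p hp0 hp1 hμ _
    (fun A => (1 / L ^ 3) * ∑ S ∈ T, if S ⊆ A then 1 else 0)
    ?_ ?_).trans (ENNReal.ofReal_le_ofReal ?_)
  · intro A
    have : (0 : ℝ) ≤ ∑ S ∈ T, if S ⊆ A then 1 else 0 :=
      Finset.sum_nonneg (fun i _ => by split_ifs <;> norm_num)
    positivity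
  · intro A hA hAs
    simp only [Set.mem_ofPred_eq, not_le] at hA
    have h1 : (((A.powersetCard 2).filter
        (fun P => ∃ a ∈ P, ∃ b ∈ P, Partner u a b)).card : ℝ) ≤
        ∑ S ∈ T, if S ⊆ A then 1 else 0 := by
      rw [← Finset.sum_filter, Finset.sum_const, nsmul_eq_mul, mul_one]
      norm_cast
      apply Finset.card_le_card
      intro P hP
      simp only [T, Finset.mem_filter, Finset.mem_powersetCard] at hP ⊢
      exact ⟨⟨⟨hP.1.1.trans hAs, hP.1.2⟩, hP.2⟩, hP.1.1⟩
    rw [one_div_mul_eq_div, le_div_iff₀ (by positivity), one_mul]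
    linarith
  · rw [Ex_smul]
    have hb := bad_config F (p := p) 2 (2 * r - 2) hp0 hn (by omega) T (by
      intro S hS
      simp only [T, Finset.mem_filter, Finset.mem_powersetCard] at hS
      obtain ⟨⟨hS1, hS2⟩, a, ha, b, hb, hab, hc⟩ := hS
      refine ⟨hS1, hS2, ?_⟩
      have hSab : S = {a, b} := by
        symm
        apply Finset.eq_of_subset_of_card_le
        · intro x hx
          simp only [Finset.mem_insert, Finset.mem_singleton] at hx
          rcases hx with rfl | rfl <;> assumption
        · rw [hS2, Finset.card_pair hab]
      have h1 := (all_sub F a (hS1 ha)).1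
      have h2 := (all_sub F b (hS1 hb)).1
      have h3 := Finset.card_union_add_card_inter a.1 b.1
      rw [hSab, Finset.sup_insert, Finset.sup_singleton]
      change (a.1 ∪ b.1).card ≤ _
      omega)
    have e : (n : ℝ) ^ (2 * r - 2) * p ^ 2 = (p * (n : ℝ) ^ (r - 1)) ^ 2 := by
      rw [mul_pow, ← pow_mul, show 2 * r - 2 = (r - 1) * 2 by omega]
      ring
    rw [mul_assoc, e] at hb
    have h5 : (p * (n : ℝ) ^ (r - 1)) ^ 2 ≤ (C * L) ^ 2 :=
      pow_le_pow_left₀ (by positivity) hC 2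
    have h6 := hb.trans (mul_le_mul_of_nonneg_left h5 (cfgCard_nonneg _))
    calc _ ≤ 1 / L ^ 3 * (cfgCard (2 * r - 2) * (C * L) ^ 2) :=
          mul_le_mul_of_nonneg_left h6 (by positivity)
      _ = _ := by field_simp

lemma bad2 {r n : ℕ} (hr : 4 ≤ r) (hn : 0 < n) (F : Finset (Finset (Fin r)))
    {p L C : ℝ} (hp0 : 0 ≤ p) (hp1 : p ≤ 1)
    (μ : PMF (Finset (FE n))) (hμ : BernoulliVia μ id (allFEdges F n) p)
    (hC : p * (n : ℝ) ^ (r - 1) ≤ C * L) :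
    μ.toOuterMeasure {H | ¬ ¬ HasAvoidable r H} ≤
      ENNReal.ofReal (∑ k ∈ Finset.Icc 1 (2 ^ (r + 1)),
        cfgCard ((r - 1) * k - 1) * C ^ k * (L ^ k / n)) := by
  let T : ℕ → Finset (Finset (FE n)) := fun k => ((allFEdges F n).powersetCard k).filter
    (fun S => (S.sup Prod.fst).card < (r - 1) * k)
  refine (markov μ _ p hp0 hp1 hμ _
    (fun A => ∑ k ∈ Finset.Icc 1 (2 ^ (r + 1)), ∑ S ∈ T k, if S ⊆ A then 1 else 0)
    ?_ ?_).trans (ENNReal.ofReal_le_ofReal ?_)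
  · intro A
    exact Finset.sum_nonneg (fun k _ => Finset.sum_nonneg
      (fun i _ => by split_ifs <;> norm_num))
  · intro A hA hAs
    simp only [Set.mem_ofPred_eq, not_not] at hA
    obtain ⟨S, hSA, hne, -, h1, h2⟩ := hA
    have hk : S.card ∈ Finset.Icc 1 (2 ^ (r + 1)) :=
      Finset.mem_Icc.2 ⟨hne.card_pos, h2⟩
    have hST : S ∈ T S.card := by
      simp only [T, Finset.mem_filter, Finset.mem_powersetCard]
      exact ⟨⟨hSA.trans hAs, trivial⟩, h1⟩
    calc (1 : ℝ) = if S ⊆ A then 1 else 0 := by rw [if_pos hSA]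
      _ ≤ ∑ S ∈ T S.card, if S ⊆ A then 1 else 0 :=
        Finset.single_le_sum (f := fun S => if S ⊆ A then (1 : ℝ) else 0)
          (fun i _ => by split_ifs <;> norm_num) hST
      _ ≤ _ := Finset.single_le_sum
          (f := fun k => ∑ S ∈ T k, if S ⊆ A then (1 : ℝ) else 0)
          (fun k _ => Finset.sum_nonneg (fun i _ => by split_ifs <;> norm_num)) hk
  · rw [Ex_sum]
    apply Finset.sum_le_sum
    intro k hk
    rw [Finset.mem_Icc] at hk
    have hk3 : 3 * 1 ≤ (r - 1) * k := Nat.mul_le_mul (by omega) hk.1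
    have hb := bad_config F (p := p) k ((r - 1) * k - 1) hp0 hn (by omega) (T k) (by
      intro S hS
      simp only [T, Finset.mem_filter, Finset.mem_powersetCard] at hS
      exact ⟨hS.1.1, hS.1.2, by omega⟩)
    have hn' : (0 : ℝ) < n := by exact_mod_cast hn
    have e : (n : ℝ) ^ ((r - 1) * k - 1) * p ^ k = (p * (n : ℝ) ^ (r - 1)) ^ k / n := by
      rw [mul_pow, ← pow_mul, eq_div_iff hn'.ne']
      calc _ = p ^ k * ((n : ℝ) ^ ((r - 1) * k - 1) * n) := by ring
        _ = _ := by rw [← pow_succ, Nat.sub_add_cancel (by omega)]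
    rw [mul_assoc, e] at hb
    have h5 : (p * (n : ℝ) ^ (r - 1)) ^ k ≤ (C * L) ^ k :=
      pow_le_pow_left₀ (by positivity) hC k
    refine hb.trans ?_
    calc _ ≤ cfgCard ((r - 1) * k - 1) * ((C * L) ^ k / n) := by
          have := cfgCard_nonneg ((r - 1) * k - 1)
          gcongr
      _ = _ := by rw [mul_pow]; ring

end events

/-- Whp the random `F`-graph `H_F(n,π₊)` satisfies: (i) the maximum
degree bound, (ii) no avoidable configuration, (iii) at most `(log n)^{8g(n)}`
low-degree vertices, (iv) at most `(log n)^3` pairs of partner `F`-edges, and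
(v) no isolated vertex. -/
theorem statement_4 (u r : ℕ) (hu : 2 ≤ u) (hr : 4 ≤ r)
    (F : Finset (Finset (Fin r))) (hFcard : ∀ e ∈ F, e.card = u) (hF : Nice u F)
    (g : ℕ → ℝ) (hg : GoodG g)
    (μ : (n : ℕ) → PMF (Finset (FE n)))
    (hμ : ∀ᶠ n : ℕ in atTop, BernoulliVia (μ n) id (allFEdges F n) (piPlus F g n)) :
    Tendsto (fun n => (μ n).toOuterMeasure
        {H | (∀ v : Fin n, (degFE H v : ℝ) ≤
                (r : ℝ) / n * (Mnum F n : ℝ) * piPlus F g n +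
                  max ((r : ℝ) / n * (Mnum F n : ℝ) * piPlus F g n) (3 * Real.log n)) ∧
             ¬ HasAvoidable r H ∧
             ((Finset.univ.filter (fun v : Fin n => (degFE H v : ℝ) ≤ 7 * g n)).card : ℝ)
               ≤ Real.log n ^ (8 * g n) ∧
             (((H.powersetCard 2).filter
                 (fun P => ∃ a ∈ P, ∃ b ∈ P, Partner u a b)).card : ℝ)
               ≤ Real.log n ^ (3 : ℕ) ∧
             (∀ v : Fin n, ∃ h ∈ H, v ∈ h.1)})
      atTop (nhds 1) := by
  obtain ⟨hginf, hgo⟩ := hg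
  have hr1 : 1 ≤ r := by omega
  set C : ℝ := (autCard F : ℝ) / r.factorial * (2 ^ (r - 1) * (r - 1).factorial) * 2 with hCdef
  have hC0 : 0 ≤ C := by positivity
  have tL : Tendsto (fun n : ℕ => Real.log n) atTop atTop :=
    Real.tendsto_log_atTop.comp tendsto_natCast_atTop_atTop
  have tLL : Tendsto (fun n : ℕ => Real.log (Real.log n)) atTop atTop :=
    Real.tendsto_log_atTop.comp tL
  have hLk : ∀ k : ℕ, Tendsto (fun n : ℕ => Real.log n ^ k / n) atTop (nhds 0) := by
    intro k
    exact (Real.isLittleO_pow_log_id_atTop (n := k)).tendsto_div_nhds_zero.comp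
      tendsto_natCast_atTop_atTop
  let ε : ℕ → ℝ := fun n => Real.exp (-(Real.log n / 2)) +
    (∑ k ∈ Finset.Icc 1 (2 ^ (r + 1)),
        cfgCard ((r - 1) * k - 1) * C ^ k * (Real.log n ^ k / n)) +
    Real.exp (1 - g n) +
    cfgCard (2 * r - 2) * C ^ 2 / Real.log n + Real.exp (-g n)
  have tε : Tendsto ε atTop (nhds 0) := by
    have e1 : Tendsto (fun n : ℕ => Real.exp (-(Real.log n / 2))) atTop (nhds 0) :=
      Real.tendsto_exp_neg_atTop_nhds_zero.comp (tL.atTop_div_const (by norm_num))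
    have e2 : Tendsto (fun n : ℕ => ∑ k ∈ Finset.Icc 1 (2 ^ (r + 1)),
        cfgCard ((r - 1) * k - 1) * C ^ k * (Real.log n ^ k / n))
        atTop (nhds 0) := by
      rw [show (0 : ℝ) = ∑ k ∈ Finset.Icc 1 (2 ^ (r + 1)),
        cfgCard ((r - 1) * k - 1) * C ^ k * 0 by simp]
      exact tendsto_finsetSum _ (fun k _ => (hLk k).const_mul _)
    have e5 : Tendsto (fun n : ℕ => Real.exp (-g n)) atTop (nhds 0) :=
      Real.tendsto_exp_neg_atTop_nhds_zero.comp hginf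
    have e3 : Tendsto (fun n : ℕ => Real.exp (1 - g n)) atTop (nhds 0) := by
      have := e5.const_mul (Real.exp 1)
      rw [mul_zero] at this
      refine this.congr (fun n => ?_)
      rw [← Real.exp_add]; ring_nf
    have e4 : Tendsto (fun n : ℕ => cfgCard (2 * r - 2) * C ^ 2 /
        Real.log n) atTop (nhds 0) := tL.const_div_atTop _
    have := (((e1.add e2).add e3).add e4).add e5
    simpa only [add_zero] using this
  have hgL : ∀ᶠ n : ℕ in atTop, g n ≤ Real.log n := by
    have h1 := hgo.bound (c := 1) one_pos
    filter_upwards [h1, tLL.eventually_ge_atTop 1, tL.eventually_ge_atTop 1] with n h1 h2 h3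
    rw [one_mul, Real.norm_eq_abs, Real.norm_eq_abs, abs_of_nonneg (a := _ / _) (by positivity)]
      at h1
    exact (le_abs_self _).trans (h1.trans (div_le_self (by linarith) h2))
  have hCL : ∀ᶠ n : ℕ in atTop, C * Real.log n ≤ n := by
    have h := (hLk 1).const_mul C
    rw [mul_zero] at h
    filter_upwards [h.eventually_le_const one_pos, eventually_gt_atTop 0] with n h1 h2
    have hn' : (0 : ℝ) < n := by exact_mod_cast h2
    rw [pow_one, ← mul_div_assoc, div_le_one hn'] at h1
    exact h1
  have hmain : ∀ᶠ n : ℕ in atTop, 1 - ENNReal.ofReal (ε n) ≤ (μ n).toOuterMeasure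
        {H | (∀ v : Fin n, (degFE H v : ℝ) ≤
                (r : ℝ) / n * (Mnum F n : ℝ) * piPlus F g n +
                  max ((r : ℝ) / n * (Mnum F n : ℝ) * piPlus F g n) (3 * Real.log n)) ∧
             ¬ HasAvoidable r H ∧
             ((Finset.univ.filter (fun v : Fin n => (degFE H v : ℝ) ≤ 7 * g n)).card : ℝ)
               ≤ Real.log n ^ (8 * g n) ∧
             (((H.powersetCard 2).filter
                 (fun P => ∃ a ∈ P, ∃ b ∈ P, Partner u a b)).card : ℝ)
               ≤ Real.log n ^ (3 : ℕ) ∧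
             (∀ v : Fin n, ∃ h ∈ H, v ∈ h.1)} := by
    filter_upwards [hμ, hgL, hCL, eventually_ge_atTop (2 * r), tL.eventually_ge_atTop 1,
      tLL.eventually_ge_atTop (7 * Real.log 2), hginf.eventually_ge_atTop 0]
      with n hμn hgn hCn hnr hL hLL hg0
    have hn0 : 0 < n := by omega
    have hn0' : (0 : ℝ) < n := by exact_mod_cast hn0
    have hl0 : 0 ≤ Real.log n + g n := by linarith
    have hp0 : 0 ≤ piPlus F g n := by unfold piPlus; positivity
    have hpC : piPlus F g n * (n : ℝ) ^ (r - 1) ≤ C * Real.log n := by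
      refine (pi_bound hr1 hnr F g hl0).trans ?_
      rw [hCdef, mul_assoc _ (2 : ℝ)]
      apply mul_le_mul_of_nonneg_left (by linarith)
      positivity
    have hp1 : piPlus F g n ≤ 1 := by
      have h1 : (n : ℝ) ≤ (n : ℝ) ^ (r - 1) :=
        le_self_pow₀ (by exact_mod_cast hn0) (by omega)
      have h2 : piPlus F g n * (n : ℝ) ^ (r - 1) ≤ 1 * (n : ℝ) ^ (r - 1) := by linarith
      exact le_of_mul_le_mul_right h2 (by positivity)
    have hN : ∀ v : Fin n, (Nv F v : ℝ) * piPlus F g n = Real.log n + g n :=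
      fun v => Nv_pi hr1 (by omega) F g v
    have hnL : (n : ℝ) = Real.exp (Real.log n) := (Real.exp_log hn0').symm
    rw [dbar_eq hr1 (by omega) F g]
    have b1 := bad1 F hp0 hp1 (μ n) hμn hN hnL hg0 hgn
    have b2 := bad2 hr hn0 F hp0 hp1 (μ n) hμn hpC
    have b3 := bad3 F hp0 hp1 (μ n) hμn hN hnL hg0 hgn hL hLL
    have b4 := bad4 hu hr hn0 F hp0 hp1 (μ n) hμn (by linarith) hpC
    have b5 := bad5 F hp0 hp1 (μ n) hμn hN hnL
    have hL0 : 0 ≤ Real.log n := by linarith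
    rw [tsub_le_iff_right]
    have q2 : 0 ≤ ∑ k ∈ Finset.Icc 1 (2 ^ (r + 1)),
        cfgCard ((r - 1) * k - 1) * C ^ k * (Real.log n ^ k / n) := by
      apply Finset.sum_nonneg
      intro k _
      have := cfgCard_nonneg ((r - 1) * k - 1)
      positivity
    have q4 : 0 ≤ cfgCard (2 * r - 2) * C ^ 2 / Real.log n := by
      have := cfgCard_nonneg (2 * r - 2)
      positivity
    simp only [ε]
    rw [ofReal_add5 (Real.exp_pos _).le q2 (Real.exp_pos _).le q4 (Real.exp_pos _).le]
    have hU : (μ n).toOuterMeasure Set.univ = 1 :=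
      ((μ n).toOuterMeasure_apply_eq_one_iff _).2 (Set.subset_univ _)
    rw [← hU]
    refine le_trans ?_ (add_le_add le_rfl
      (add_le_add (add_le_add (add_le_add (add_le_add b1 b2) b3) b4) b5))
    refine le_trans ?_ (add_le_add le_rfl ((measure_union_le _ _).trans
      (add_le_add ((measure_union_le _ _).trans (add_le_add ((measure_union_le _ _).trans
        (add_le_add (measure_union_le _ _) le_rfl)) le_rfl)) le_rfl)))
    refine le_trans ?_ (measure_union_le _ _)
    apply measure_mono
    intro H _
    simp only [Set.mem_union, Set.mem_ofPred_eq]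
    tauto
  refine tendsto_of_tendsto_of_tendsto_of_le_of_le' ?_ tendsto_const_nhds hmain
    (Eventually.of_forall (fun n => ?_))
  · have h1 : Tendsto (fun n => ENNReal.ofReal (ε n)) atTop (nhds 0) := by
      have := ENNReal.tendsto_ofReal tε
      rwa [ENNReal.ofReal_zero] at this
    have := ENNReal.Tendsto.sub (tendsto_const_nhds (x := (1 : ℝ≥0∞))) h1 (Or.inl (by simp))
    simpa using this
  · calc _ ≤ (μ n).toOuterMeasure Set.univ := measure_mono (Set.subset_univ _)
      _ = 1 := ((μ n).toOuterMeasure_apply_eq_one_iff _).2 (Set.subset_univ _)
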